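/- arXiv:2404.11081 — 6 statements merged into one kernel-verified Lean document; each statement's English description precedes it below -/
import Mathlib

section
/- Let k ≥ 1 and let M be the k×k real tridiagonal matrix described in the context. For every vector w ∈ ℝ^k whose entries sum to zero (i.e., w is orthogonal to the all-ones vector), one has wᵀ M w ≤ −4·sin²(π/(2k)) · ‖w‖², where ‖w‖ is the Euclidean norm. -/
open Matrix

/-- The `k×k` tridiagonal matrix `M = Σ_{i=0}^{k−2} (E_{i,i+1} + E_{i+1,i} − E_{i,i} − E_{i+1,i+1})`,
given by its entrywise description: `M i j = 1` if `|i−j| = 1`, the diagonal entry `M i i` is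
`−2` in the interior, `−1` at the two ends (and `0` when `k = 1`), and all other entries are `0`. -/
def triM (k : ℕ) : Matrix (Fin k) (Fin k) ℝ :=
  Matrix.of fun i j =>
    if ((i : ℤ) - (j : ℤ)).natAbs = 1 then 1
    else if i = j then
      (if (i : ℕ) = 0 then 0 else -1) + (if (i : ℕ) = k - 1 then 0 else -1)
    else 0

/-- The quadratic form of `triM` is minus the Dirichlet energy of the path. -/
theorem triM_quadForm_eq (m : ℕ) (u : ℕ → ℝ) :
    (fun i : Fin (m + 1) => u i) ⬝ᵥ (triM (m + 1)).mulVec (fun i => u i) =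
      -∑ i ∈ Finset.range m, (u (i + 1) - u i) ^ 2 := by
  have row (i : Fin (m + 1)) : (triM (m + 1)).mulVec (fun i => u i) i =
      (if (i : ℕ) = 0 then 0 else u (i - 1) - u i) +
        (if (i : ℕ) = m then 0 else u (i + 1) - u i) := by
    obtain ⟨i, hi⟩ := i
    have entry (j : Fin (m + 1)) : triM (m + 1) ⟨i, hi⟩ j * u j =
        (if (j : ℕ) = i - 1 then (if i = 0 then 0 else u j) else 0) +
        (if (j : ℕ) = i + 1 then u j else 0) +
        (if (j : ℕ) = i then
          ((if i = 0 then 0 else -1) + (if i = m then 0 else -1)) * u j else 0) := by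
      obtain ⟨j, hj⟩ := j
      simp only [triM, Matrix.of_apply, Fin.mk.injEq, Nat.add_sub_cancel]
      split_ifs <;> first | omega | grind
    simp only [Matrix.mulVec, dotProduct, entry]
    rw [Fin.sum_univ_eq_sum_range (fun j =>
        (if j = i - 1 then (if i = 0 then 0 else u j) else 0) +
        (if j = i + 1 then u j else 0) +
        (if j = i then ((if i = 0 then 0 else -1) + (if i = m then 0 else -1)) * u j else 0))]
    simp only [Finset.sum_add_distrib, Finset.sum_ite_eq', Finset.mem_range]
    split_ifs <;> first | omega | ring
  simp only [dotProduct, row]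
  rw [Fin.sum_univ_eq_sum_range (fun i => u i * ((if i = 0 then 0 else u (i - 1) - u i) +
    (if i = m then 0 else u (i + 1) - u i)))]
  simp only [mul_add, Finset.sum_add_distrib]
  rw [Finset.sum_range_succ', Finset.sum_range_succ (n := m)]
  have last : ∑ i ∈ Finset.range m, u i * (if i = m then 0 else u (i + 1) - u i) =
      ∑ i ∈ Finset.range m, u i * (u (i + 1) - u i) :=
    Finset.sum_congr rfl fun i hi => by rw [if_neg (Finset.mem_range.1 hi).ne]
  rw [last]
  simp only [if_true, mul_zero, add_zero, Nat.add_eq_zero_iff, one_ne_zero, and_false, if_false,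
    Nat.add_sub_cancel]
  rw [← Finset.sum_add_distrib, ← Finset.sum_neg_distrib]
  exact Finset.sum_congr rfl fun i _ => by ring

/-- Summation by parts against the partial sums of `u`. -/
theorem sum_partialSum_mul_sub (u : ℕ → ℝ) (n : ℕ) :
    ∑ i ∈ Finset.range n, (∑ j ∈ Finset.range (i + 1), u j) * (u (i + 1) - u i) =
      (∑ j ∈ Finset.range (n + 1), u j) * u n - ∑ i ∈ Finset.range (n + 1), u i ^ 2 := by
  induction n with
  | zero => simp [sq]
  | succ n ih =>
    rw [Finset.sum_range_succ, ih, Finset.sum_range_succ u (n + 1),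
      Finset.sum_range_succ (fun i => u i ^ 2) (n + 1)]
    ring

theorem sin_add_sin_eq_sub_four_sin_sq (θ x : ℝ) :
    Real.sin (x * θ) + Real.sin ((x + 2) * θ) =
      (2 - 4 * Real.sin (θ / 2) ^ 2) * Real.sin ((x + 1) * θ) := by
  have h : 2 - 4 * Real.sin (θ / 2) ^ 2 = 2 * Real.cos θ := by
    rw [Real.sin_sq_eq_half_sub, mul_div_cancel₀ _ (two_ne_zero' ℝ)]
    ring
  rw [h, show x * θ = (x + 1) * θ - θ by ring, show (x + 2) * θ = (x + 1) * θ + θ by ring,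
    Real.sin_sub, Real.sin_add]
  ring

/-- Ground-state estimate for the Dirichlet problem, with `sin (i * θ)` as ground state. -/
theorem sin_ratio_mul_sq_le (u : ℕ → ℝ) (θ : ℝ) (n : ℕ)
    (hpos : ∀ i ≤ n, 0 < Real.sin (((i : ℝ) + 1) * θ)) :
    (1 - Real.sin (n * θ) / Real.sin (((n : ℝ) + 1) * θ)) *
        (∑ j ∈ Finset.range (n + 1), u j) ^ 2 ≤
      ∑ i ∈ Finset.range (n + 1), u i ^ 2 - 4 * Real.sin (θ / 2) ^ 2 *
        ∑ i ∈ Finset.range n, (∑ j ∈ Finset.range (i + 1), u j) ^ 2 := by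
  induction n with
  | zero => simp
  | succ n ih =>
    have ih := ih fun i hi => hpos i (hi.trans n.le_succ)
    have hb := hpos n n.le_succ
    have hc := hpos (n + 1) le_rfl
    have hrec := sin_add_sin_eq_sub_four_sin_sq θ n
    rw [Finset.sum_range_succ u (n + 1), Finset.sum_range_succ (fun i => u i ^ 2) (n + 1),
      Finset.sum_range_succ (fun i => (∑ j ∈ Finset.range (i + 1), u j) ^ 2) n]
    push_cast at hc ⊢
    rw [show (n : ℝ) + 1 + 1 = n + 2 by ring] at hc ⊢
    set a := Real.sin (n * θ)
    set b := Real.sin (((n : ℝ) + 1) * θ)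
    set c := Real.sin (((n : ℝ) + 2) * θ)
    set l := 4 * Real.sin (θ / 2) ^ 2
    set S := ∑ j ∈ Finset.range (n + 1), u j
    have hl : l = 2 - a / b - c / b := by
      field_simp
      linarith
    have key : 0 ≤ (b * (S + u (n + 1)) - c * S) ^ 2 / (b * c) := by positivity
    have expand : (b * (S + u (n + 1)) - c * S) ^ 2 / (b * c) =
        u (n + 1) ^ 2 - l * S ^ 2 + (1 - a / b) * S ^ 2 -
          (1 - b / c) * (S + u (n + 1)) ^ 2 := by
      rw [hl]
      field_simp
      ring
    linarith

/-- The discrete Dirichlet inequality for the partial sums of a sequence of total sum zero. -/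
theorem sum_partialSum_sq_le (m : ℕ) (u : ℕ → ℝ) (hu : ∑ i ∈ Finset.range (m + 1), u i = 0) :
    4 * Real.sin (Real.pi / (m + 1) / 2) ^ 2 *
        ∑ i ∈ Finset.range m, (∑ j ∈ Finset.range (i + 1), u j) ^ 2 ≤
      ∑ i ∈ Finset.range (m + 1), u i ^ 2 := by
  cases m with
  | zero => simp [sq_nonneg]
  | succ n =>
    set θ := Real.pi / (((n + 1 : ℕ) : ℝ) + 1) with hθ
    have hθ0 : 0 < θ := by positivity
    have hπ : ((n : ℝ) + 2) * θ = Real.pi := by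
      rw [hθ]
      push_cast
      field_simp
      ring
    have hpos : ∀ i ≤ n, 0 < Real.sin (((i : ℝ) + 1) * θ) := fun i hi => by
      have hi : (i : ℝ) ≤ n := by exact_mod_cast hi
      apply Real.sin_pos_of_pos_of_lt_pi (by positivity)
      rw [← hπ]
      gcongr ?_ * θ
      linarith
    have hground := sin_ratio_mul_sq_le u θ n hpos
    have hb := hpos n le_rfl
    have hrec := sin_add_sin_eq_sub_four_sin_sq θ n
    rw [hπ, Real.sin_pi, add_zero] at hrec
    rw [hrec, mul_div_cancel_right₀ _ hb.ne'] at hground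
    rw [Finset.sum_range_succ] at hu
    rw [Finset.sum_range_succ (fun i => u i ^ 2) (n + 1),
      Finset.sum_range_succ (fun i => (∑ j ∈ Finset.range (i + 1), u j) ^ 2) n,
      eq_neg_of_add_eq_zero_right hu]
    linarith

/-- The discrete Wirtinger inequality on a path. -/
theorem four_sin_sq_mul_sum_sq_le (m : ℕ) (u : ℕ → ℝ)
    (hu : ∑ i ∈ Finset.range (m + 1), u i = 0) :
    4 * Real.sin (Real.pi / (m + 1) / 2) ^ 2 * ∑ i ∈ Finset.range (m + 1), u i ^ 2 ≤
      ∑ i ∈ Finset.range m, (u (i + 1) - u i) ^ 2 := by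
  have hD := sum_partialSum_sq_le m u hu
  have hparts := sum_partialSum_mul_sub u m
  rw [hu, zero_mul, zero_sub] at hparts
  set l := 4 * Real.sin (Real.pi / (m + 1) / 2) ^ 2
  have hl : 0 ≤ l := by positivity
  have hsq : 0 ≤ ∑ i ∈ Finset.range m,
      ((u (i + 1) - u i) + l * ∑ j ∈ Finset.range (i + 1), u j) ^ 2 :=
    Finset.sum_nonneg fun i _ => sq_nonneg _
  have expand : ∑ i ∈ Finset.range m,
      ((u (i + 1) - u i) + l * ∑ j ∈ Finset.range (i + 1), u j) ^ 2 =
      ∑ i ∈ Finset.range m, (u (i + 1) - u i) ^ 2 +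
        2 * l * ∑ i ∈ Finset.range m, (∑ j ∈ Finset.range (i + 1), u j) * (u (i + 1) - u i) +
        l * (l * ∑ i ∈ Finset.range m, (∑ j ∈ Finset.range (i + 1), u j) ^ 2) := by
    simp only [Finset.mul_sum (Finset.range m), ← Finset.sum_add_distrib]
    exact Finset.sum_congr rfl fun i _ => by ring
  rw [expand, hparts] at hsq
  linarith [mul_le_mul_of_nonneg_left hD hl]

/-- For every vector `w ∈ ℝ^k` whose entries sum to zero,
`wᵀ M w ≤ −4 sin²(π/(2k)) ‖w‖²` where `‖w‖` is the Euclidean norm. -/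
theorem triM_quadForm_le (k : ℕ) (hk : 1 ≤ k) (w : Fin k → ℝ) (hw : ∑ i, w i = 0) :
    w ⬝ᵥ (triM k).mulVec w ≤ -4 * Real.sin (Real.pi / (2 * k)) ^ 2 * ∑ i, w i ^ 2 := by
  obtain ⟨m, rfl⟩ := Nat.exists_eq_add_of_le' hk
  obtain ⟨u, rfl⟩ : ∃ u : ℕ → ℝ, w = fun i : Fin (m + 1) => u i :=
    ⟨fun n => if h : n < m + 1 then w ⟨n, h⟩ else 0, by ext i; simp only [i.is_lt, dif_pos, Fin.eta]⟩
  rw [Fin.sum_univ_eq_sum_range] at hw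
  rw [triM_quadForm_eq, Fin.sum_univ_eq_sum_range (fun i => u i ^ 2), mul_comm (2 : ℝ),
    ← div_div, Nat.cast_add_one]
  linarith [four_sin_sq_mul_sum_sq_le m u hw]
end

section
/- Let k ≥ 1, let M be the k×k real tridiagonal matrix described in the context, and let d ∈ ℝ^k be a vector with all entries nonnegative and at least one entry positive; let d₀ be the smallest positive entry of d. Then for every vector w ∈ ℝ^k, wᵀ (M − diag(d)) w ≤ −(1/(2k)) · min(d₀, 4·sin²(π/(2k))) · ‖w‖², where diag(d) is the diagonal matrix with diagonal entries d and ‖w‖ is the Euclidean norm. -/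
open Matrix

/-- The quadratic form of `triM` is minus the Dirichlet energy of the path. -/
lemma triM_quadForm (n : ℕ) (w : Fin (n + 1) → ℝ) :
    w ⬝ᵥ (triM (n + 1)).mulVec w = -∑ l : Fin n, (w l.succ - w l.castSucc) ^ 2 := by
  have entry (i j : Fin (n + 1)) : w i * (triM (n + 1) i j * w j) =
      (if (i : ℕ) = j + 1 then w i * w j else 0) + (if (j : ℕ) = i + 1 then w i * w j else 0)
      + (if i = j then if (j : ℕ) = 0 then 0 else -(w j ^ 2) else 0)
      + (if i = j then if (j : ℕ) = n then 0 else -(w j ^ 2) else 0) := by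
    rcases lt_trichotomy i j with h | rfl | h
    · have h' : (i : ℕ) < j := h
      have h₁ : ((i : ℤ) - (j : ℤ)).natAbs = 1 ↔ (j : ℕ) = i + 1 := by omega
      have h₂ : ¬ (i : ℕ) = j + 1 := by omega
      simp only [triM, Matrix.of_apply, h₁, h₂, h.ne, if_false]
      split_ifs <;> ring
    · simp only [triM, Matrix.of_apply, sub_self, Int.natAbs_zero, zero_ne_one, if_false,
        if_true, Nat.add_sub_cancel, Nat.left_eq_add, one_ne_zero]
      split_ifs <;> ring
    · have h' : (j : ℕ) < i := h
      have h₁ : ((i : ℤ) - (j : ℤ)).natAbs = 1 ↔ (i : ℕ) = j + 1 := by omega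
      have h₂ : ¬ (j : ℕ) = i + 1 := by omega
      simp only [triM, Matrix.of_apply, h₁, h₂, h.ne', if_false]
      split_ifs <;> ring
  have off_diag : ∑ i : Fin (n + 1), ∑ j : Fin (n + 1),
      (if (i : ℕ) = j + 1 then w i * w j else 0) = ∑ l : Fin n, w l.succ * w l.castSucc := by
    rw [Fin.sum_univ_succ]
    have h₀ : ∑ j : Fin (n + 1),
        (if ((0 : Fin (n + 1)) : ℕ) = j + 1 then w 0 * w j else 0) = 0 :=
      Finset.sum_eq_zero fun j _ => if_neg (by simp)
    rw [h₀, zero_add]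
    refine Finset.sum_congr rfl fun l _ => ?_
    rw [Finset.sum_eq_single l.castSucc]
    · simp
    · intro j _ hj
      refine if_neg fun h => hj (Fin.ext ?_)
      simp only [Fin.val_succ, Fin.val_castSucc] at h ⊢
      omega
    · simp
  have off_diag' : ∑ i : Fin (n + 1), ∑ j : Fin (n + 1),
      (if (j : ℕ) = i + 1 then w i * w j else 0) = ∑ l : Fin n, w l.succ * w l.castSucc := by
    rw [Finset.sum_comm, ← off_diag]
    simp only [mul_comm]
  have diag_zero : ∑ i : Fin (n + 1), (if (i : ℕ) = 0 then 0 else -(w i ^ 2))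
      = -∑ l : Fin n, w l.succ ^ 2 := by
    simp [Fin.sum_univ_succ]
  have diag_last : ∑ i : Fin (n + 1), (if (i : ℕ) = n then 0 else -(w i ^ 2))
      = -∑ l : Fin n, w l.castSucc ^ 2 := by
    simp [Fin.sum_univ_castSucc, ne_of_lt]
  simp only [dotProduct, Matrix.mulVec, Finset.mul_sum, entry, Finset.sum_add_distrib,
    off_diag, off_diag', Finset.sum_ite_eq, Finset.mem_univ, if_true, diag_zero, diag_last]
  simp only [← Finset.sum_neg_distrib, ← Finset.sum_add_distrib]
  exact Finset.sum_congr rfl fun l _ => by ring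

/-- Along a path, the squared increment is at most the distance times the Dirichlet energy. -/
lemma sq_sub_le_dist_mul_energy {n i j : ℕ} (v : ℕ → ℝ) (hi : i ≤ n) (hj : j ≤ n) :
    (v i - v j) ^ 2 ≤ |(i : ℝ) - j| * ∑ l ∈ Finset.range n, (v (l + 1) - v l) ^ 2 := by
  wlog hij : j ≤ i generalizing i j
  · rw [abs_sub_comm, ← neg_sub, neg_sq]
    exact this hj hi (by omega)
  have hsub : Finset.Ico j i ⊆ Finset.range n := fun l hl => by
    simp only [Finset.mem_Ico, Finset.mem_range] at hl ⊢
    omega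
  have htel : ∑ l ∈ Finset.Ico j i, (v (l + 1) - v l) = v i - v j := by
    rw [Finset.sum_Ico_eq_sub _ hij, Finset.sum_range_sub, Finset.sum_range_sub,
      sub_sub_sub_cancel_right]
  rw [← htel, abs_of_nonneg (sub_nonneg.2 (Nat.cast_le.2 hij))]
  refine sq_sum_le_card_mul_sum_sq.trans ?_
  rw [Nat.card_Ico, Nat.cast_sub hij]
  exact mul_le_mul_of_nonneg_left
    (Finset.sum_le_sum_of_subset_of_nonneg hsub fun _ _ _ => sq_nonneg _)
    (sub_nonneg.2 (Nat.cast_le.2 hij))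

lemma two_mul_sum_abs_sub_le {n j : ℕ} (hj : j ≤ n) :
    2 * ∑ i ∈ Finset.range (n + 1), |(i : ℝ) - j| ≤ n * (n + 1) := by
  have hrefl := Finset.sum_range_reflect (fun i : ℕ => |(i : ℝ) - j|) (n + 1)
  rw [two_mul]
  nth_rewrite 1 [← hrefl]
  rw [← Finset.sum_add_distrib]
  refine (Finset.sum_le_card_nsmul _ _ (n : ℝ) fun i hi => ?_).trans
    (by simp [mul_comm])
  have hi' : i ≤ n := by simpa [Nat.lt_succ_iff] using hi
  have h₁ : (i : ℝ) ≤ n := Nat.cast_le.2 hi'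
  have h₂ : (j : ℝ) ≤ n := Nat.cast_le.2 hj
  have h₃ : (0 : ℝ) ≤ i := i.cast_nonneg
  have h₄ : (0 : ℝ) ≤ j := j.cast_nonneg
  rw [Nat.add_sub_cancel, Nat.cast_sub hi']
  rcases abs_cases ((n : ℝ) - i - j) with h | h <;> rcases abs_cases ((i : ℝ) - j) with h' | h' <;>
    linarith

lemma sum_sq_le_energy {n j : ℕ} (v : ℕ → ℝ) (hj : j ≤ n) :
    ∑ i ∈ Finset.range (n + 1), v i ^ 2 ≤ 2 * (n + 1) * v j ^ 2
      + n * (n + 1) * ∑ l ∈ Finset.range n, (v (l + 1) - v l) ^ 2 := by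
  set E := ∑ l ∈ Finset.range n, (v (l + 1) - v l) ^ 2
  have hE0 : 0 ≤ E := Finset.sum_nonneg fun _ _ => sq_nonneg _
  calc ∑ i ∈ Finset.range (n + 1), v i ^ 2
      ≤ ∑ i ∈ Finset.range (n + 1), (2 * v j ^ 2 + 2 * |(i : ℝ) - j| * E) := by
        refine Finset.sum_le_sum fun i hi => ?_
        have hi' : i ≤ n := by simpa [Nat.lt_succ_iff] using hi
        have := sq_sub_le_dist_mul_energy v hi' hj
        nlinarith [sq_nonneg (v i - 2 * v j)]
    _ = 2 * (n + 1) * v j ^ 2 + 2 * (∑ i ∈ Finset.range (n + 1), |(i : ℝ) - j|) * E := by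
        rw [Finset.sum_add_distrib, Finset.sum_const, Finset.card_range, nsmul_eq_mul,
          ← Finset.sum_mul, ← Finset.mul_sum]
        push_cast
        ring
    _ ≤ _ := add_le_add_right (mul_le_mul_of_nonneg_right (two_mul_sum_abs_sub_le hj) hE0) _

lemma mul_four_sin_sq_le_two (n : ℕ) :
    (n : ℝ) * (4 * Real.sin (Real.pi / (2 * (n + 1 : ℕ))) ^ 2) ≤ 2 := by
  obtain rfl | rfl | rfl | hn : n = 0 ∨ n = 1 ∨ n = 2 ∨ 3 ≤ n := by omega
  · simp
  · have h : Real.pi / (2 * (1 + 1 : ℕ)) = Real.pi / 4 := by norm_num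
    rw [h, Real.sin_pi_div_four, div_pow, Real.sq_sqrt (by norm_num)]
    norm_num
  · have h : Real.pi / (2 * (2 + 1 : ℕ)) = Real.pi / 6 := by norm_num
    rw [h, Real.sin_pi_div_six]
    norm_num
  · have hn' : (3 : ℝ) ≤ n := by exact_mod_cast hn
    have hsin : Real.sin (Real.pi / (2 * (n + 1 : ℕ))) ^ 2
        ≤ (Real.pi / (2 * (n + 1 : ℕ))) ^ 2 := Real.sin_sq_le_sq
    have hpi : Real.pi ^ 2 ≤ 10 := by nlinarith [Real.pi_lt_d2, Real.pi_pos]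
    calc (n : ℝ) * (4 * Real.sin (Real.pi / (2 * (n + 1 : ℕ))) ^ 2)
        ≤ n * (4 * (Real.pi / (2 * (n + 1 : ℕ))) ^ 2) := by gcongr
      _ = n * Real.pi ^ 2 / (n + 1) ^ 2 := by push_cast; field_simp; ring
      _ ≤ n * 10 / (n + 1) ^ 2 := by gcongr
      _ ≤ 2 := by
        rw [div_le_iff₀ (by positivity)]
        nlinarith

/-- If `d ∈ ℝ^k` has nonnegative entries, at least one of which is positive, and `d₀` is the
smallest positive entry of `d`, then for every `w ∈ ℝ^k`,
`wᵀ (M − diag(d)) w ≤ −(1/(2k)) min(d₀, 4 sin²(π/(2k))) ‖w‖²`. -/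
theorem triM_sub_diag_quadForm_le (k : ℕ) (hk : 1 ≤ k) (d : Fin k → ℝ)
    (hd : ∀ i, 0 ≤ d i) (hdpos : ∃ i, 0 < d i) (d₀ : ℝ)
    (hd₀ : IsLeast {x : ℝ | 0 < x ∧ ∃ i, d i = x} d₀) (w : Fin k → ℝ) :
    w ⬝ᵥ (triM k - Matrix.diagonal d).mulVec w
      ≤ -(1 / (2 * k)) * min d₀ (4 * Real.sin (Real.pi / (2 * k)) ^ 2) * ∑ i, w i ^ 2 := by
  obtain ⟨n, rfl⟩ := Nat.exists_eq_add_of_le' hk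
  obtain ⟨⟨hd₀pos, j, hj⟩, -⟩ := hd₀
  set c := min d₀ (4 * Real.sin (Real.pi / (2 * (n + 1 : ℕ))) ^ 2)
  have hc0 : 0 ≤ c := le_min hd₀pos.le (by positivity)
  have hcn : n * c ≤ 2 :=
    (mul_le_mul_of_nonneg_left (min_le_right _ _) n.cast_nonneg).trans (mul_four_sin_sq_le_two n)
  let v : ℕ → ℝ := fun i => if h : i < n + 1 then w ⟨i, h⟩ else 0
  have hv (i : Fin (n + 1)) : v i = w i := dif_pos i.is_lt
  have hbound := sum_sq_le_energy v (Nat.lt_succ_iff.1 j.is_lt)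
  have hvs (l : Fin n) : v (l + 1) = w l.succ := hv l.succ
  have hvc (l : Fin n) : v l = w l.castSucc := hv l.castSucc
  simp only [Finset.sum_range, hv, hvs, hvc] at hbound
  have hdiag : c * w j ^ 2 ≤ w ⬝ᵥ (Matrix.diagonal d).mulVec w := by
    have hsum : w ⬝ᵥ (Matrix.diagonal d).mulVec w = ∑ i, d i * w i ^ 2 := by
      simp only [dotProduct, Matrix.mulVec_diagonal]
      exact Finset.sum_congr rfl fun i _ => by ring
    rw [hsum]
    calc c * w j ^ 2 ≤ d j * w j ^ 2 := by
          rw [hj]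
          exact mul_le_mul_of_nonneg_right (min_le_left _ _) (sq_nonneg _)
      _ ≤ _ := Finset.single_le_sum (f := fun i => d i * w i ^ 2)
          (fun i _ => mul_nonneg (hd i) (sq_nonneg _)) (Finset.mem_univ j)
  rw [Matrix.sub_mulVec, dotProduct_sub, triM_quadForm]
  set E := ∑ l : Fin n, (w l.succ - w l.castSucc) ^ 2
  have hE0 : 0 ≤ E := Finset.sum_nonneg fun _ _ => sq_nonneg _
  have hn : (0 : ℝ) < 2 * (n + 1) := by positivity
  have key : 1 / (2 * ((n : ℝ) + 1)) * c * ∑ i, w i ^ 2 ≤ c * w j ^ 2 + E := by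
    calc 1 / (2 * ((n : ℝ) + 1)) * c * ∑ i, w i ^ 2
        ≤ 1 / (2 * ((n : ℝ) + 1)) * c * (2 * (n + 1) * w j ^ 2 + n * (n + 1) * E) := by gcongr
      _ = c * w j ^ 2 + n * c / 2 * E := by field_simp
      _ ≤ c * w j ^ 2 + 1 * E := by gcongr; linarith
      _ = _ := by ring
  push_cast
  linarith
end

section
/- Under the hypotheses in the context, for every i ∈ {1,…,n} and every t ≥ 0, x_i(t) ≤ (max(1, 2β/α))^n · exp(−α·t/2). -/
open Finset

/-- A scalar Grönwall-type comparison with exponentially decaying forcing at half the rate. -/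
lemma le_mul_exp_of_deriv_le {f : ℝ → ℝ} {α C : ℝ}
    (hf : ∀ t, 0 ≤ t → DifferentiableAt ℝ f t) (h0 : f 0 ≤ C)
    (hode : ∀ t, 0 ≤ t → deriv f t ≤ -α * f t + α / 2 * (C * Real.exp (-α * t / 2)))
    {t : ℝ} (ht : 0 ≤ t) : f t ≤ C * Real.exp (-α * t / 2) := by
  have hderiv (s : ℝ) (hs : 0 ≤ s) :
      HasDerivAt (fun s => Real.exp (α * s) * (f s - C * Real.exp (-α * s / 2)))
        (Real.exp (α * s) *
          (deriv f s - (-α * f s + α / 2 * (C * Real.exp (-α * s / 2))))) s := by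
    have h1 : HasDerivAt (fun s => Real.exp (α * s)) (Real.exp (α * s) * (α * 1)) s :=
      ((hasDerivAt_id' s).const_mul α).exp
    have h2 : HasDerivAt (fun s => Real.exp (-α * s / 2))
        (Real.exp (-α * s / 2) * (-α * 1 / 2)) s :=
      (((hasDerivAt_id' s).const_mul (-α)).div_const 2).exp
    refine (h1.fun_mul ((hf s hs).hasDerivAt.fun_sub (h2.const_mul C))).congr_deriv ?_
    ring
  have hanti : AntitoneOn (fun s => Real.exp (α * s) * (f s - C * Real.exp (-α * s / 2)))
      (Set.Ici 0) := by
    refine antitoneOn_of_deriv_nonpos (convex_Ici 0)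
      (fun s hs => (hderiv s hs).continuousAt.continuousWithinAt)
      (fun s hs => (hderiv s (interior_subset hs)).differentiableAt.differentiableWithinAt)
      fun s hs => ?_
    have hs' : 0 ≤ s := interior_subset hs
    rw [(hderiv s hs').deriv]
    exact mul_nonpos_of_nonneg_of_nonpos (Real.exp_pos _).le (sub_nonpos.2 (hode s hs'))
  have hle := hanti (Set.mem_Ici.2 le_rfl) (Set.mem_Ici.2 ht) ht
  simp only [mul_zero, zero_div, Real.exp_zero, mul_one, one_mul] at hle
  exact sub_nonpos.1 (nonpos_of_mul_nonpos_right (hle.trans (sub_nonpos.2 h0)) (Real.exp_pos _))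

/-- (Paper, Lemma `bound_sequence_inequalities`, exponential-decay form.)
If nonnegative differentiable functions `x_1, …, x_n` (indexed here by `Fin n`) satisfy
`x_i(0) ≤ 1` and the differential inequalities
`x_i′(t) ≤ −α_i x_i(t) + Σ_{j<i} β_{i,j} x_j(t)` for `t ≥ 0`
(for `i = 1` the sum is empty, so this is `x_1′(t) ≤ −α_1 x_1(t)`),
with `α_i ≥ α > 0`, `β_{i,j} ≥ 0` and `Σ_{j<i} β_{i,j} ≤ β` for `β > 0`, then
`x_i(t) ≤ (max(1, 2β/α))^n · exp(−α t/2)` for all `i` and all `t ≥ 0`. -/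
theorem sequence_inequalities_exp_decay (n : ℕ) (hn : 1 ≤ n)
    (x : Fin n → ℝ → ℝ) (a : Fin n → ℝ) (b : Fin n → Fin n → ℝ) (α β : ℝ)
    (hα : 0 < α) (hβ : 0 < β)
    (hdiff : ∀ (i : Fin n) (t : ℝ), 0 ≤ t → DifferentiableAt ℝ (x i) t)
    (hnonneg : ∀ (i : Fin n) (t : ℝ), 0 ≤ t → 0 ≤ x i t)
    (hinit : ∀ i : Fin n, x i 0 ≤ 1)
    (ha : ∀ i : Fin n, α ≤ a i)
    (hb : ∀ i j : Fin n, j < i → 0 ≤ b i j)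
    (hbsum : ∀ i : Fin n, ∑ j ∈ Finset.univ.filter (fun j => j < i), b i j ≤ β)
    (hode : ∀ (i : Fin n) (t : ℝ), 0 ≤ t →
      deriv (x i) t ≤ -(a i) * x i t + ∑ j ∈ Finset.univ.filter (fun j => j < i), b i j * x j t) :
    ∀ (i : Fin n) (t : ℝ), 0 ≤ t →
      x i t ≤ (max 1 (2 * β / α)) ^ n * Real.exp (-α * t / 2) := by
  set M : ℝ := max 1 (2 * β / α)
  have hM1 : 1 ≤ M := le_max_left _ _
  have hβM : β ≤ α / 2 * M := by
    have h : 2 * β / α ≤ M := le_max_right _ _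
    rw [div_le_iff₀ hα] at h
    linarith
  have key : ∀ (i : Fin n) (t : ℝ), 0 ≤ t →
      x i t ≤ M ^ (i.val + 1) * Real.exp (-α * t / 2) := by
    intro i
    induction i using WellFoundedLT.induction with
    | ind i ih =>
      intro t ht
      refine le_mul_exp_of_deriv_le (hdiff i) ((hinit i).trans (one_le_pow₀ hM1)) ?_ ht
      intro s hs
      have hE : 0 ≤ M ^ i.val * Real.exp (-α * s / 2) := by positivity
      have hsum : ∑ j ∈ Finset.univ.filter (fun j => j < i), b i j * x j s ≤
          α / 2 * (M ^ (i.val + 1) * Real.exp (-α * s / 2)) :=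
        calc _ ≤ ∑ j ∈ Finset.univ.filter (fun j => j < i),
                b i j * (M ^ i.val * Real.exp (-α * s / 2)) := by
              refine Finset.sum_le_sum fun j hj => ?_
              have hji : j < i := (Finset.mem_filter.1 hj).2
              refine mul_le_mul_of_nonneg_left ((ih j hji s hs).trans ?_) (hb i j hji)
              exact mul_le_mul_of_nonneg_right (pow_le_pow_right₀ hM1 hji) (Real.exp_pos _).le
          _ = (∑ j ∈ Finset.univ.filter (fun j => j < i), b i j) *
                (M ^ i.val * Real.exp (-α * s / 2)) := (Finset.sum_mul ..).symm
          _ ≤ α / 2 * M * (M ^ i.val * Real.exp (-α * s / 2)) :=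
              mul_le_mul_of_nonneg_right ((hbsum i).trans hβM) hE
          _ = _ := by ring
      have hdecay := mul_le_mul_of_nonneg_right (ha i) (hnonneg i s hs)
      linarith [hode i s hs]
  intro i t ht
  exact (key i t ht).trans
    (mul_le_mul_of_nonneg_right (pow_le_pow_right₀ hM1 i.isLt) (Real.exp_pos _).le)
end

section
/- Under the hypotheses in the context, for every i ∈ {1,…,n} and every t ≥ 0, x_i(t) ≤ (Σ_{j=0}^{i−1} (β·t)^j / j!) · exp(−α·t). -/
open Finset

/-- The derivative of a truncated exponential series is the series truncated one term earlier. -/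
lemma hasDerivAt_sum_range_pow_div_factorial (β t : ℝ) (m : ℕ) :
    HasDerivAt (fun s : ℝ => ∑ j ∈ Finset.range (m + 1), (β * s) ^ j / (Nat.factorial j : ℝ))
      (β * ∑ j ∈ Finset.range m, (β * t) ^ j / (Nat.factorial j : ℝ)) t := by
  induction m with
  | zero => simpa using hasDerivAt_const t (1 : ℝ)
  | succ m ih =>
    have hpow : HasDerivAt (fun s : ℝ => (β * s) ^ (m + 1) / (Nat.factorial (m + 1) : ℝ))
        (β * ((β * t) ^ m / (Nat.factorial m : ℝ))) t := by
      have h := ((((hasDerivAt_id t).const_mul β).pow (m + 1)).div_const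
        (Nat.factorial (m + 1) : ℝ))
      refine h.congr_deriv ?_
      have hm : (Nat.factorial m : ℝ) ≠ 0 := by positivity
      rw [Nat.factorial_succ]
      push_cast
      simp only [id]
      field_simp
    rw [Finset.sum_range_succ _ m, mul_add]
    simp_rw [Finset.sum_range_succ _ (m + 1)]
    exact ih.add hpow

/-- A function with nonpositive value at `0` and nonpositive derivative on `[0, ∞)` is nonpositive
there. -/
lemma nonpos_of_hasDerivAt_nonpos {g g' : ℝ → ℝ} (h0 : g 0 ≤ 0)
    (hg : ∀ t, 0 ≤ t → HasDerivAt g (g' t) t) (hg' : ∀ t, 0 ≤ t → g' t ≤ 0) {t : ℝ}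
    (ht : 0 ≤ t) : g t ≤ 0 := by
  have hanti : AntitoneOn g (Set.Ici 0) := by
    refine antitoneOn_of_deriv_nonpos (convex_Ici 0)
      (fun s hs => (hg s hs).continuousAt.continuousWithinAt) ?_ ?_ <;>
      intro s hs <;> have hs' : 0 ≤ s := interior_subset hs
    · exact (hg s hs').differentiableAt.differentiableWithinAt
    · exact (hg s hs').deriv ▸ hg' s hs'
  exact (hanti Set.self_mem_Ici ht ht).trans h0

/-- (Paper, Lemma `bound_sequence_inequalities`, polynomial-prefactor form.)
If nonnegative differentiable functions `x_1, …, x_n` (indexed here by `Fin n`, so the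
function with 1-based label `i` is `x ⟨i−1⟩`) satisfy `x_i(0) ≤ 1` and the differential
inequalities `x_i′(t) ≤ −α_i x_i(t) + Σ_{j<i} β_{i,j} x_j(t)` for `t ≥ 0`
(for `i = 1` the sum is empty, so this is `x_1′(t) ≤ −α_1 x_1(t)`),
with `α_i ≥ α > 0`, `β_{i,j} ≥ 0` and `Σ_{j<i} β_{i,j} ≤ β` for `β > 0`, then for all `t ≥ 0`,
`x_i(t) ≤ (Σ_{j=0}^{i−1} (β t)^j / j!) · exp(−α t)` (the index `i : Fin n` has 1-based
label `i+1`, so the sum ranges over `j ∈ {0, …, i}` below). -/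
theorem sequence_inequalities_poly_decay (n : ℕ) (hn : 1 ≤ n)
    (x : Fin n → ℝ → ℝ) (a : Fin n → ℝ) (b : Fin n → Fin n → ℝ) (α β : ℝ)
    (hα : 0 < α) (hβ : 0 < β)
    (hdiff : ∀ (i : Fin n) (t : ℝ), 0 ≤ t → DifferentiableAt ℝ (x i) t)
    (hnonneg : ∀ (i : Fin n) (t : ℝ), 0 ≤ t → 0 ≤ x i t)
    (hinit : ∀ i : Fin n, x i 0 ≤ 1)
    (ha : ∀ i : Fin n, α ≤ a i)
    (hb : ∀ i j : Fin n, j < i → 0 ≤ b i j)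
    (hbsum : ∀ i : Fin n, ∑ j ∈ Finset.univ.filter (fun j => j < i), b i j ≤ β)
    (hode : ∀ (i : Fin n) (t : ℝ), 0 ≤ t →
      deriv (x i) t ≤ -(a i) * x i t + ∑ j ∈ Finset.univ.filter (fun j => j < i), b i j * x j t) :
    ∀ (i : Fin n) (t : ℝ), 0 ≤ t →
      x i t ≤ (∑ j ∈ Finset.range ((i : ℕ) + 1), (β * t) ^ j / (Nat.factorial j)) *
        Real.exp (-α * t) := by
  intro i
  induction i using WellFoundedLT.induction with
  | ind i ih =>
  intro t ht
  have hg : x i t * Real.exp (α * t) -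
      ∑ j ∈ Finset.range ((i : ℕ) + 1), (β * t) ^ j / (Nat.factorial j : ℝ) ≤ 0 := by
    refine nonpos_of_hasDerivAt_nonpos
      (g := fun s => x i s * Real.exp (α * s) -
        ∑ j ∈ Finset.range ((i : ℕ) + 1), (β * s) ^ j / (Nat.factorial j : ℝ))
      ?_ (fun s hs => ((hdiff i s hs).hasDerivAt.mul
        (((hasDerivAt_id s).const_mul α).exp)).sub
          (hasDerivAt_sum_range_pow_div_factorial β s i)) ?_ ht
    · simpa [Finset.sum_range_succ'] using hinit i
    · intro s hs
      set S := ∑ j ∈ Finset.range (i : ℕ), (β * s) ^ j / (Nat.factorial j : ℝ) with hS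
      have hS0 : 0 ≤ S := Finset.sum_nonneg fun j _ => by positivity
      have hprev : ∀ j < i, x j s * Real.exp (α * s) ≤ S := by
        intro j hj
        have h := mul_le_mul_of_nonneg_right (ih j hj s hs) (Real.exp_pos (α * s)).le
        rw [mul_assoc, ← Real.exp_add, neg_mul, neg_add_cancel, Real.exp_zero, mul_one] at h
        refine h.trans (Finset.sum_le_sum_of_subset_of_nonneg
          (Finset.range_mono (Nat.succ_le_of_lt hj)) fun k _ _ => by positivity)
      have hsum : (∑ j ∈ Finset.univ.filter (fun j => j < i), b i j * x j s) *
          Real.exp (α * s) ≤ β * S := by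
        calc _ = ∑ j ∈ Finset.univ.filter (fun j => j < i),
              b i j * (x j s * Real.exp (α * s)) := by
              simp_rw [Finset.sum_mul, mul_assoc]
          _ ≤ ∑ j ∈ Finset.univ.filter (fun j => j < i), b i j * S := by
              refine Finset.sum_le_sum fun j hj => ?_
              have hji := (Finset.mem_filter.mp hj).2
              exact mul_le_mul_of_nonneg_left (hprev j hji) (hb i j hji)
          _ ≤ β * S := by
              rw [← Finset.sum_mul]
              exact mul_le_mul_of_nonneg_right (hbsum i) hS0
      have hlin : deriv (x i) s + α * x i s ≤
          ∑ j ∈ Finset.univ.filter (fun j => j < i), b i j * x j s := by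
        nlinarith [hode i s hs, mul_nonneg (sub_nonneg.mpr (ha i)) (hnonneg i s hs)]
      have hexp := mul_le_mul_of_nonneg_right hlin (Real.exp_pos (α * s)).le
      simp only [id, mul_one]
      linarith
  rw [neg_mul, Real.exp_neg, ← div_eq_mul_inv, le_div_iff₀ (Real.exp_pos _)]
  linarith
end

section
/- Under the hypotheses in the context, for every natural number n the set {α ∈ ι : dist(S̃_α, S) = n} is finite, and its cardinality is at most Z̃ · |S| · |{x ∈ ℤ^d : Σ_{i=1}^{d} |x_i| = n}|; in particular it is at most Z̃ · |S| · 2^d · C(n + d − 1, d − 1), where C denotes the binomial coefficient. -/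
open Finset

/-- The `ℓ¹` (Manhattan) distance between two points of the integer lattice `ℤ^d`. -/
def latticeDist {d : ℕ} (x y : Fin d → ℤ) : ℕ := ∑ i, (x i - y i).natAbs

/-- The `ℓ¹` distance between two subsets of `ℤ^d`: the minimum (infimum) of the pairwise
distances. -/
noncomputable def latticeSetDist {d : ℕ} (A B : Set (Fin d → ℤ)) : ℕ :=
  sInf {n : ℕ | ∃ a ∈ A, ∃ b ∈ B, latticeDist a b = n}

lemma exists_latticeDist_eq_latticeSetDist {d : ℕ} {A B : Set (Fin d → ℤ)}
    (hA : A.Nonempty) (hB : B.Nonempty) :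
    ∃ a ∈ A, ∃ b ∈ B, latticeDist a b = latticeSetDist A B :=
  have ⟨a, ha⟩ := hA
  have ⟨b, hb⟩ := hB
  Nat.sInf_mem (s := {n : ℕ | ∃ a ∈ A, ∃ b ∈ B, latticeDist a b = n}) ⟨_, a, ha, b, hb, rfl⟩

lemma card_natTuples_sum_eq (d n : ℕ) :
    Nat.card {f : Fin d → ℕ // ∑ i, f i = n} = (d + n - 1).choose n := by
  rw [← Nat.card_congr (Sym.equivNatSumOfFintype (Fin d) n), Nat.card_eq_fintype_card,
    Sym.card_sym_eq_choose, Fintype.card_fin]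

/-- A lattice point is determined by the signs and the absolute values of its coordinates. -/
lemma injective_sign_natAbs (d n : ℕ) :
    Function.Injective fun x : {x : Fin d → ℤ | ∑ i, (x i).natAbs = n} ↦
      ((fun i ↦ decide (0 ≤ x.1 i), ⟨fun i ↦ (x.1 i).natAbs, x.2⟩) :
        (Fin d → Bool) × {f : Fin d → ℕ // ∑ i, f i = n}) := by
  rintro ⟨x, hx⟩ ⟨y, hy⟩ h
  simp only [Prod.mk.injEq, Subtype.mk.injEq, funext_iff, decide_eq_decide] at h
  ext i
  have h₁ := h.1 i
  have h₂ := h.2 i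
  dsimp only
  lia

instance finite_natTuples_sum_eq (d n : ℕ) : Finite {f : Fin d → ℕ // ∑ i, f i = n} :=
  .of_equiv _ (Sym.equivNatSumOfFintype (Fin d) n)

lemma finite_latticeSphere (d n : ℕ) : {x : Fin d → ℤ | ∑ i, (x i).natAbs = n}.Finite :=
  Set.finite_coe_iff.1 (.of_injective _ (injective_sign_natAbs d n))

lemma ncard_latticeSphere_le (d n : ℕ) :
    {x : Fin d → ℤ | ∑ i, (x i).natAbs = n}.ncard ≤ 2 ^ d * (d + n - 1).choose n := by
  have h := Nat.card_le_card_of_injective _ (injective_sign_natAbs d n)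
  rwa [Nat.card_prod, card_natTuples_sum_eq, Nat.card_eq_fintype_card (α := Fin d → Bool),
    Fintype.card_fun, Fintype.card_bool, Fintype.card_fin, Nat.card_coe_set_eq] at h

/-- If every member of a family meets at most `Z` members, then every point lies in at most
`Z` members. -/
lemma finite_ncard_mem_le {ι X : Type*} {A : ι → Set X} {Z : ℕ}
    (hfin : ∀ i, {j | (A i ∩ A j).Nonempty}.Finite)
    (hcard : ∀ i, {j | (A i ∩ A j).Nonempty}.ncard ≤ Z) (x : X) :
    {i | x ∈ A i}.Finite ∧ {i | x ∈ A i}.ncard ≤ Z := by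
  obtain h | ⟨i, hi⟩ := {i | x ∈ A i}.eq_empty_or_nonempty
  · simp [h]
  · have hsub : {i | x ∈ A i} ⊆ {j | (A i ∩ A j).Nonempty} := fun j hj ↦ ⟨x, hi, hj⟩
    exact ⟨(hfin i).subset hsub, (Set.ncard_le_ncard hsub (hfin i)).trans (hcard i)⟩

/-- (Paper, proof of Lemma `lr_summation`.)  Let `(S̃_α)_{α∈ι}` be a family of finite nonempty
subsets of `ℤ^d` such that each `S̃_α` intersects at most `Z̃` members of the family, and let
`S ⊆ ℤ^d` be finite and nonempty.  Then for every `n : ℕ` the index set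
`{α : dist(S̃_α, S) = n}` is finite with at most
`Z̃ · |S| · |{x ∈ ℤ^d : Σ_i |x_i| = n}|` elements, and in particular at most
`Z̃ · |S| · 2^d · C(n + d − 1, d − 1)` elements. -/
theorem card_indices_at_dist_le (d : ℕ) (hd : 1 ≤ d) {ι : Type*}
    (St : ι → Set (Fin d → ℤ))
    (hStfin : ∀ α, (St α).Finite) (hStne : ∀ α, (St α).Nonempty)
    (Z : ℕ)
    (hZfin : ∀ α, {α' : ι | (St α ∩ St α').Nonempty}.Finite)
    (hZcard : ∀ α, {α' : ι | (St α ∩ St α').Nonempty}.ncard ≤ Z)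
    (S : Set (Fin d → ℤ)) (hS : S.Finite) (hSne : S.Nonempty) (n : ℕ) :
    {α : ι | latticeSetDist (St α) S = n}.Finite ∧
    {α : ι | latticeSetDist (St α) S = n}.ncard
      ≤ Z * S.ncard * {x : Fin d → ℤ | ∑ i, (x i).natAbs = n}.ncard ∧
    {α : ι | latticeSetDist (St α) S = n}.ncard
      ≤ Z * S.ncard * (2 ^ d * Nat.choose (n + d - 1) (d - 1)) := by
  set T := {x : Fin d → ℤ | ∑ i, (x i).natAbs = n}
  have hT : T.Finite := finite_latticeSphere d n
  have hP : (S ×ˢ T).Finite := hS.prod hT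
  have hpoint := finite_ncard_mem_le hZfin hZcard
  have hsub : {α | latticeSetDist (St α) S = n} ⊆
      ⋃ p ∈ hP.toFinset, {α | p.1 + p.2 ∈ St α} := by
    intro α hα
    obtain ⟨a, ha, b, hb, hab⟩ := exists_latticeDist_eq_latticeSetDist (hStne α) hSne
    simp only [Set.mem_iUnion]
    exact ⟨(b, a - b), hP.mem_toFinset.2 ⟨hb, hab.trans hα⟩, by simpa using ha⟩
  have hU : (⋃ p ∈ hP.toFinset, {α | p.1 + p.2 ∈ St α}).Finite :=
    hP.toFinset.finite_toSet.biUnion fun p _ ↦ (hpoint _).1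
  have hle : {α | latticeSetDist (St α) S = n}.ncard ≤ Z * S.ncard * T.ncard :=
    calc {α | latticeSetDist (St α) S = n}.ncard
        ≤ (⋃ p ∈ hP.toFinset, {α | p.1 + p.2 ∈ St α}).ncard := Set.ncard_le_ncard hsub hU
      _ ≤ ∑ p ∈ hP.toFinset, {α | p.1 + p.2 ∈ St α}.ncard := Finset.set_ncard_biUnion_le _ _
      _ ≤ #hP.toFinset * Z := Finset.sum_le_card_nsmul _ _ _ fun p _ ↦ (hpoint _).2
      _ = Z * S.ncard * T.ncard := by
        rw [← Set.ncard_eq_toFinset_card _ hP, Set.ncard_prod]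
        ring
  refine ⟨hU.subset hsub, hle, hle.trans (Nat.mul_le_mul_left _ ?_)⟩
  have hchoose : (n + d - 1).choose (d - 1) = (d + n - 1).choose n := by
    rw [add_comm n d]
    exact Nat.choose_symm_of_eq_add (by lia)
  exact hchoose ▸ ncard_latticeSphere_le d n
end

section
/- Under the hypotheses in the context, for every integer k ≥ 1, Σ over k-tuples (α_1,…,α_k) ∈ ι^k of min(x · exp(T − (1/λ)·Σ_{j=1}^{k} f(α_j)), 1) is at most max(x,1)^k · (Σ_{α∈ι} min(exp(T − f(α)/λ), 1))^k, where all (possibly infinite) sums are taken in the extended nonnegative reals [0,∞] (every summand is nonnegative). -/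
open scoped ENNReal
open Finset

theorem min_exp_sub_add_le_mul {T a b : ℝ} (hT : 0 ≤ T) (ha : 0 ≤ a) (hb : 0 ≤ b) :
    min (Real.exp (T - (a + b))) 1 ≤ min (Real.exp (T - a)) 1 * min (Real.exp (T - b)) 1 := by
  have key (y : ℝ) : min (Real.exp y) 1 = Real.exp (min y 0) := by
    rw [Real.exp_monotone.map_min, Real.exp_zero]
  rw [key, key, key, ← Real.exp_add, Real.exp_le_exp]
  grind

theorem min_exp_sub_sum_le_prod {ι : Type*} (s : Finset ι) {g : ι → ℝ} (hg : ∀ i, 0 ≤ g i)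
    {T : ℝ} (hT : 0 ≤ T) :
    min (Real.exp (T - ∑ i ∈ s, g i)) 1 ≤ ∏ i ∈ s, min (Real.exp (T - g i)) 1 := by
  classical
  induction s using Finset.induction_on with
  | empty => simp
  | insert i s hi ih =>
    rw [sum_insert hi, prod_insert hi]
    exact (min_exp_sub_add_le_mul hT (hg i) (sum_nonneg fun j _ => hg j)).trans (by gcongr)

theorem min_mul_one_le_max_mul_min {x e : ℝ} (he : 0 ≤ e) :
    min (x * e) 1 ≤ max x 1 * min e 1 := by
  rw [mul_min_of_nonneg _ _ (by positivity), mul_one]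
  gcongr <;> simp

theorem ENNReal.tsum_fin_prod_eq_pow {ι : Type*} (h : ι → ℝ≥0∞) (k : ℕ) :
    ∑' a : Fin k → ι, ∏ j, h (a j) = (∑' i, h i) ^ k := by
  induction k with
  | zero => simp
  | succ k ih =>
    rw [← (Fin.consEquiv fun _ : Fin (k + 1) => ι).tsum_eq, ENNReal.tsum_prod']
    simp [Fin.prod_univ_succ, ENNReal.tsum_mul_left, ENNReal.tsum_mul_right, ih, pow_succ']

/-- (Paper, proof of Lemma `lr_summation`, Eq. (single-sum reduction), `m = 0` case.)
For `f : ι → ℝ` nonnegative, `λ > 0`, `T ≥ 0` and `x > 0`, the sum over `k`-tuples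
`(α_1,…,α_k) ∈ ι^k` of `min(x·exp(T − (1/λ)Σ_j f(α_j)), 1)` is at most
`max(x,1)^k · (Σ_α min(exp(T − f(α)/λ), 1))^k`, all sums taken in `[0,∞]`. -/
theorem tuple_sum_min_exp_le_pow {ι : Type*} (f : ι → ℝ) (hf : ∀ α, 0 ≤ f α)
    (lam T x : ℝ) (hlam : 0 < lam) (hT : 0 ≤ T) (hx : 0 < x) (k : ℕ) (hk : 1 ≤ k) :
    (∑' a : Fin k → ι,
        ENNReal.ofReal (min (x * Real.exp (T - (1 / lam) * ∑ j, f (a j))) 1))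
      ≤ ENNReal.ofReal (max x 1) ^ k *
        (∑' α : ι, ENNReal.ofReal (min (Real.exp (T - f α / lam)) 1)) ^ k := by
  rw [← ENNReal.tsum_fin_prod_eq_pow, ← ENNReal.tsum_mul_left]
  refine ENNReal.tsum_le_tsum fun a => ?_
  rw [← ENNReal.ofReal_prod_of_nonneg fun _ _ => by positivity,
    ← ENNReal.ofReal_pow (by positivity), ← ENNReal.ofReal_mul (by positivity)]
  apply ENNReal.ofReal_le_ofReal
  rw [one_div_mul_eq_div, sum_div]
  calc
    _ ≤ max x 1 * min (Real.exp (T - ∑ j, f (a j) / lam)) 1 :=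
      min_mul_one_le_max_mul_min (Real.exp_pos _).le
    _ ≤ max x 1 ^ k * ∏ j, min (Real.exp (T - f (a j) / lam)) 1 := by
      gcongr
      · exact le_self_pow₀ (le_max_right x 1) (by lia)
      · exact min_exp_sub_sum_le_prod univ (fun j => div_nonneg (hf (a j)) hlam.le) hT
end
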